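/- Let R be a commutative ring, A and B ideals, n ≥ 3. Then the relative elementary subgroup E(n,R,AB) is contained in the mixed commutator subgroup [E(n,A), E(n,B)], where E(n,I) is generated by elementary matrices of level I. -/

import Mathlib

def elemSL (n : ℕ) (R : Type*) [CommRing R] (i j : Fin n) (hij : i ≠ j) (t : R) :
    Matrix.SpecialLinearGroup (Fin n) R :=
  ⟨Matrix.transvection i j t, Matrix.det_transvection_of_ne i j hij t⟩

/-- The (absolute) elementary subgroup `E(n,R)`. -/
def elemGroup (n : ℕ) (R : Type*) [CommRing R] :
    Subgroup (Matrix.SpecialLinearGroup (Fin n) R) :=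
  Subgroup.closure {x | ∃ (i j : Fin n) (h : i ≠ j) (t : R), x = elemSL n R i j h t}

/-- The unrelativised elementary subgroup `E(n,I)` of level `I`. -/
def elemGroupLevel (n : ℕ) (R : Type*) [CommRing R] (I : Ideal R) :
    Subgroup (Matrix.SpecialLinearGroup (Fin n) R) :=
  Subgroup.closure {x | ∃ (i j : Fin n) (h : i ≠ j), ∃ c ∈ I, x = elemSL n R i j h c}

/-- The relative elementary subgroup `E(n,R,I)`: the normal closure of `E(n,I)`
in `E(n,R)`, generated by `E(n,R)`-conjugates of elementary matrices of level `I`. -/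
def relElemGroup (n : ℕ) (R : Type*) [CommRing R] (I : Ideal R) :
    Subgroup (Matrix.SpecialLinearGroup (Fin n) R) :=
  Subgroup.closure {x | ∃ g ∈ elemGroup n R, ∃ (i j : Fin n) (h : i ≠ j),
    ∃ c ∈ I, x = g * elemSL n R i j h c * g⁻¹}

open Matrix
open scoped commutatorElement

/-- The matrices underlying a subgroup of the special linear group, as a submonoid. -/
def matrixSubmonoid {n : ℕ} {R : Type*} [CommRing R]
    (H : Subgroup (Matrix.SpecialLinearGroup (Fin n) R)) : Submonoid (Matrix (Fin n) (Fin n) R) :=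
  H.toSubmonoid.map Matrix.SpecialLinearGroup.coeMonoidHom

section

variable {n : ℕ} {R : Type*} [CommRing R]

theorem mem_matrixSubmonoid {H : Subgroup (Matrix.SpecialLinearGroup (Fin n) R)}
    {M : Matrix (Fin n) (Fin n) R} :
    M ∈ matrixSubmonoid H ↔ ∃ x ∈ H, (x : Matrix (Fin n) (Fin n) R) = M :=
  Iff.rfl

theorem coe_mem_matrixSubmonoid {H : Subgroup (Matrix.SpecialLinearGroup (Fin n) R)}
    {x : Matrix.SpecialLinearGroup (Fin n) R} :
    (x : Matrix (Fin n) (Fin n) R) ∈ matrixSubmonoid H ↔ x ∈ H := by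
  rw [mem_matrixSubmonoid]
  refine ⟨?_, fun hx => ⟨x, hx, rfl⟩⟩
  rintro ⟨y, hy, hyx⟩
  rwa [← Subtype.ext hyx]

theorem one_add_vecMulVec_mul_right {u v w : Fin n → R} (h : v ⬝ᵥ u = 0) :
    (1 + vecMulVec u v) * (1 + vecMulVec u w) = 1 + vecMulVec u (v + w) := by
  simp only [mul_add, add_mul, one_mul, mul_one, vecMulVec_mul_vecMulVec, h, zero_smul,
    vecMulVec_zero, vecMulVec_add]
  abel

theorem one_add_vecMulVec_mul_left {u w v : Fin n → R} (h : v ⬝ᵥ w = 0) :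
    (1 + vecMulVec u v) * (1 + vecMulVec w v) = 1 + vecMulVec (u + w) v := by
  simp only [mul_add, add_mul, one_mul, mul_one, vecMulVec_mul_vecMulVec, h, zero_smul,
    vecMulVec_zero, add_vecMulVec]
  abel

theorem one_add_vecMulVec_sum_right_mem {ι : Type*}
    (S : Submonoid (Matrix (Fin n) (Fin n) R)) (s : Finset ι) (u : Fin n → R)
    (f : ι → Fin n → R) (h : ∀ i ∈ s, f i ⬝ᵥ u = 0)
    (hS : ∀ i ∈ s, 1 + vecMulVec u (f i) ∈ S) :
    1 + vecMulVec u (∑ i ∈ s, f i) ∈ S := by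
  classical
  induction s using Finset.induction_on with
  | empty => simp
  | insert i s hi ih =>
    rw [Finset.sum_insert hi, ← one_add_vecMulVec_mul_right (h i (by simp))]
    exact S.mul_mem (hS i (by simp)) (ih (fun j hj => h j (by simp [hj]))
      fun j hj => hS j (by simp [hj]))

theorem one_add_vecMulVec_sum_left_mem {ι : Type*}
    (S : Submonoid (Matrix (Fin n) (Fin n) R)) (s : Finset ι) (v : Fin n → R)
    (f : ι → Fin n → R) (h : ∀ i ∈ s, v ⬝ᵥ f i = 0)
    (hS : ∀ i ∈ s, 1 + vecMulVec (f i) v ∈ S) :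
    1 + vecMulVec (∑ i ∈ s, f i) v ∈ S := by
  classical
  induction s using Finset.induction_on with
  | empty => simp
  | insert i s hi ih =>
    rw [Finset.sum_insert hi, add_comm (f i), ← one_add_vecMulVec_mul_left (h i (by simp))]
    exact S.mul_mem (ih (fun j hj => h j (by simp [hj])) fun j hj => hS j (by simp [hj]))
      (hS i (by simp))

theorem coe_elemSL (i j : Fin n) (hij : i ≠ j) (c : R) :
    (elemSL n R i j hij c : Matrix (Fin n) (Fin n) R) =
      1 + vecMulVec (Pi.single i c) (Pi.single j 1) := by
  ext k l
  simp [elemSL, transvection, vecMulVec_apply, single_apply, Pi.single_apply, ← ite_and, eq_comm,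
    and_comm]

theorem one_add_single_mem_elemGroupLevel {I : Ideal R} {i j : Fin n} (hij : i ≠ j) {c d : R}
    (h : c * d ∈ I) :
    1 + vecMulVec (Pi.single i c) (Pi.single j d) ∈ matrixSubmonoid (elemGroupLevel n R I) := by
  have : (1 + vecMulVec (Pi.single i c) (Pi.single j d) : Matrix (Fin n) (Fin n) R) =
      elemSL n R i j hij (c * d) := by
    rw [coe_elemSL]
    ext k l
    simp only [Matrix.add_apply, vecMulVec_apply, Pi.single_apply]
    split_ifs <;> simp
  rw [this, coe_mem_matrixSubmonoid]
  exact Subgroup.subset_closure ⟨i, j, hij, _, h, rfl⟩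

theorem one_add_column_mem_elemGroupLevel {I : Ideal R} {k : Fin n} {u : Fin n → R}
    (hk : u k = 0) (hu : ∀ i, u i ∈ I) :
    1 + vecMulVec u (Pi.single k 1) ∈ matrixSubmonoid (elemGroupLevel n R I) := by
  rw [← Finset.univ_sum_single u]
  refine one_add_vecMulVec_sum_left_mem _ _ _ _ (fun i _ => ?_) fun i _ => ?_
  · obtain rfl | hik := eq_or_ne i k
    · simp [hk]
    · simp [hik.symm]
  · obtain rfl | hik := eq_or_ne i k
    · simp [hk]
    · exact one_add_single_mem_elemGroupLevel hik (by simpa using hu i)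

theorem one_add_row_mem_elemGroupLevel {I : Ideal R} {k : Fin n} {v : Fin n → R}
    (hk : v k = 0) (hv : ∀ i, v i ∈ I) :
    1 + vecMulVec (Pi.single k 1) v ∈ matrixSubmonoid (elemGroupLevel n R I) := by
  rw [← Finset.univ_sum_single v]
  refine one_add_vecMulVec_sum_right_mem _ _ _ _ (fun i _ => ?_) fun i _ => ?_
  · obtain rfl | hik := eq_or_ne i k
    · simp [hk]
    · simp [hik]
  · obtain rfl | hik := eq_or_ne i k
    · simp [hk]
    · exact one_add_single_mem_elemGroupLevel hik.symm (by simpa using hv i)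

theorem one_add_vecMulVec_mem_commutator {H K : Subgroup (Matrix.SpecialLinearGroup (Fin n) R)}
    {u v e f : Fin n → R} (hvu : v ⬝ᵥ u = 0) (hvf : v ⬝ᵥ f = 0) (hef : e ⬝ᵥ f = 1)
    (hH : 1 + vecMulVec u e ∈ matrixSubmonoid H) (hK : 1 + vecMulVec f v ∈ matrixSubmonoid K) :
    1 + vecMulVec u v ∈ matrixSubmonoid ⁅H, K⁆ := by
  obtain ⟨x, hx, hxu⟩ := mem_matrixSubmonoid.1 hH
  obtain ⟨y, hy, hyv⟩ := mem_matrixSubmonoid.1 hK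
  refine mem_matrixSubmonoid.2 ⟨⁅x, y⁆, Subgroup.commutator_mem_commutator hx hy, ?_⟩
  have key : (1 + vecMulVec u v) *
      ((y * x : Matrix.SpecialLinearGroup (Fin n) R) : Matrix (Fin n) (Fin n) R) =
      ((x * y : Matrix.SpecialLinearGroup (Fin n) R) : Matrix (Fin n) (Fin n) R) := by
    rw [Matrix.SpecialLinearGroup.coe_mul, Matrix.SpecialLinearGroup.coe_mul, hxu, hyv]
    simp only [mul_add, add_mul, one_mul, mul_one, vecMulVec_mul_vecMulVec, hvu, hvf, hef,
      zero_smul, one_smul, vecMulVec_zero, mul_zero]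
    abel
  have hxy : ⁅x, y⁆ = (x * y) * (y * x)⁻¹ := by group
  rw [hxy, Matrix.SpecialLinearGroup.coe_mul, ← key, mul_assoc,
    ← Matrix.SpecialLinearGroup.coe_mul,
    mul_inv_cancel, Matrix.SpecialLinearGroup.coe_one, mul_one]

theorem one_add_vecMulVec_mem_of_both_zero {A B : Ideal R} {a b : R} (ha : a ∈ A) (hb : b ∈ B)
    {u v : Fin n → R} {k : Fin n} (hu : u k = 0) (hv : v k = 0) (hvu : v ⬝ᵥ u = 0) :
    1 + vecMulVec ((a * b) • u) v ∈
      matrixSubmonoid ⁅elemGroupLevel n R A, elemGroupLevel n R B⁆ := by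
  have huv : vecMulVec ((a * b) • u) v = vecMulVec (a • u) (b • v) := by
    ext i j
    simp only [vecMulVec_apply, Pi.smul_apply, smul_eq_mul]
    ring
  rw [huv]
  refine one_add_vecMulVec_mem_commutator (e := Pi.single k 1) (f := Pi.single k 1)
    (by simp [hvu]) (by simp [hv]) (by simp)
    (one_add_column_mem_elemGroupLevel (by simp [hu]) fun i => ?_)
    (one_add_row_mem_elemGroupLevel (by simp [hv]) fun i => ?_)
  · exact A.mul_mem_right _ ha
  · exact B.mul_mem_right _ hb

theorem Fin.exists_ne_ne_of_three_le (hn : 3 ≤ n) (i j : Fin n) : ∃ k, k ≠ i ∧ k ≠ j := by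
  have hc : ({i, j} : Finset (Fin n)).card < Fintype.card (Fin n) := by
    rw [Fintype.card_fin]
    exact Finset.card_le_two.trans_lt hn
  obtain ⟨k, hk⟩ := Finset.exists_mem_notMem_of_card_lt_card (t := Finset.univ) hc
  exact ⟨k, by simpa using hk⟩

theorem one_add_vecMulVec_mem_of_zero (hn : 3 ≤ n) {A B : Ideal R} {a b : R} (ha : a ∈ A)
    (hb : b ∈ B) {u v : Fin n → R} {k : Fin n} (hv : v k = 0) (hvu : v ⬝ᵥ u = 0) :
    1 + vecMulVec ((a * b) • u) v ∈
      matrixSubmonoid ⁅elemGroupLevel n R A, elemGroupLevel n R B⁆ := by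
  have hu : u = (u - Pi.single k (u k)) + Pi.single k (u k) := by simp
  have hk : v ⬝ᵥ (Pi.single k (u k)) = 0 := by simp [hv]
  rw [hu, smul_add, ← one_add_vecMulVec_mul_left (by rw [dotProduct_smul, hk, smul_zero])]
  refine Submonoid.mul_mem _ (one_add_vecMulVec_mem_of_both_zero ha hb (k := k) (by simp) hv
    (by rw [dotProduct_sub, hvu, hk, sub_zero])) ?_
  rw [← Finset.univ_sum_single v]
  refine one_add_vecMulVec_sum_right_mem _ _ _ _ (fun i _ => ?_) fun i _ => ?_ <;>
    obtain rfl | hik := eq_or_ne i k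
  · simp [hv]
  · simp [hik]
  · simp [hv]
  · obtain ⟨j, hji, hjk⟩ := Fin.exists_ne_ne_of_three_le hn i k
    exact one_add_vecMulVec_mem_of_both_zero ha hb (k := j) (by simp [hjk]) (by simp [hji])
      (by simp [hik])

/-- A row orthogonal to a unimodular column is a combination of the Koszul relations. -/
theorem eq_sum_of_dotProduct_eq_zero {u v w : Fin n → R} (hwu : w ⬝ᵥ u = 1)
    (hvu : v ⬝ᵥ u = 0) :
    v = ∑ pq : Fin n × Fin n, (v pq.1 * w pq.2) • (Pi.single pq.1 (u pq.2) -
      Pi.single pq.2 (u pq.1)) := by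
  ext i
  simp only [Fintype.sum_prod_type, Finset.sum_apply, Pi.smul_apply, Pi.sub_apply, smul_eq_mul,
    mul_sub, Finset.sum_sub_distrib]
  have h1 : ∑ p, ∑ q, v p * w q * (Pi.single p (u q) : Fin n → R) i = v i * (w ⬝ᵥ u) := by
    rw [Finset.sum_eq_single i (fun p _ hp => by simp [hp.symm]) (by simp)]
    simp [dotProduct, Finset.mul_sum, mul_assoc]
  have h2 : ∑ p, ∑ q, v p * w q * (Pi.single q (u p) : Fin n → R) i = w i * (v ⬝ᵥ u) := by
    rw [Finset.sum_comm, Finset.sum_eq_single i (fun p _ hp => by simp [hp.symm]) (by simp)]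
    simp only [Pi.single_eq_same, dotProduct, Finset.mul_sum]
    exact Finset.sum_congr rfl fun _ _ => by ring
  rw [h1, h2, hwu, hvu]
  simp

theorem one_add_vecMulVec_mem_of_unimodular (hn : 3 ≤ n) {A B : Ideal R} {c : R}
    (hc : c ∈ A * B) {u v w : Fin n → R} (hwu : w ⬝ᵥ u = 1) (hvu : v ⬝ᵥ u = 0) :
    1 + vecMulVec (c • u) v ∈
      matrixSubmonoid ⁅elemGroupLevel n R A, elemGroupLevel n R B⁆ := by
  refine Submodule.mul_induction_on (C := fun c => 1 + vecMulVec (c • u) v ∈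
    matrixSubmonoid ⁅elemGroupLevel n R A, elemGroupLevel n R B⁆) hc (fun a ha b hb => ?_)
    fun x y hx hy => ?_
  · have horth (p q : Fin n) :
        ((v p * w q) • (Pi.single p (u q) - Pi.single q (u p)) : Fin n → R) ⬝ᵥ u = 0 := by
      simp [sub_dotProduct, mul_comm]
    rw [eq_sum_of_dotProduct_eq_zero hwu hvu]
    refine one_add_vecMulVec_sum_right_mem _ _ _ _ (fun pq _ => ?_) fun pq _ => ?_
    · rw [dotProduct_smul, horth, smul_zero]
    · obtain ⟨k, hkp, hkq⟩ := Fin.exists_ne_ne_of_three_le hn pq.1 pq.2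
      exact one_add_vecMulVec_mem_of_zero hn ha hb (k := k) (by simp [hkp, hkq]) (horth _ _)
  · rw [add_smul, ← one_add_vecMulVec_mul_left (by rw [dotProduct_smul, hvu, smul_zero])]
    exact Submonoid.mul_mem _ hx hy

theorem coe_conj_elemSL (g : Matrix.SpecialLinearGroup (Fin n) R) {i j : Fin n} (hij : i ≠ j)
    (c : R) :
    ((g * elemSL n R i j hij c * g⁻¹ : Matrix.SpecialLinearGroup (Fin n) R) :
      Matrix (Fin n) (Fin n) R) =
      1 + vecMulVec (c • (g : Matrix (Fin n) (Fin n) R).col i)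
        (((g⁻¹ : Matrix.SpecialLinearGroup (Fin n) R) : Matrix (Fin n) (Fin n) R).row j) := by
  rw [Matrix.SpecialLinearGroup.coe_mul, Matrix.SpecialLinearGroup.coe_mul, coe_elemSL,
    mul_add, add_mul, mul_one, ← Matrix.SpecialLinearGroup.coe_mul, mul_inv_cancel, Matrix.SpecialLinearGroup.coe_one,
    mul_vecMulVec, vecMulVec_mul]
  congr 2
  · ext; simp [mul_comm]
  · simp

end

theorem relElem_le_commutator (n : ℕ) (hn : 3 ≤ n) (R : Type*) [CommRing R]
    (A B : Ideal R) :
    relElemGroup n R (A * B) ≤ ⁅elemGroupLevel n R A, elemGroupLevel n R B⁆ := by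
  rw [relElemGroup, Subgroup.closure_le]
  rintro _ ⟨g, -, i, j, hij, c, hc, rfl⟩
  have hg (k : Fin n) :
      ((g⁻¹ : Matrix.SpecialLinearGroup (Fin n) R) : Matrix (Fin n) (Fin n) R).row k ⬝ᵥ
      (g : Matrix (Fin n) (Fin n) R).col i = (1 : Matrix (Fin n) (Fin n) R) k i := by
    rw [← Matrix.SpecialLinearGroup.coe_one, ← inv_mul_cancel g,
      Matrix.SpecialLinearGroup.coe_mul]
    rfl
  rw [SetLike.mem_coe, ← coe_mem_matrixSubmonoid, coe_conj_elemSL]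
  exact one_add_vecMulVec_mem_of_unimodular hn hc ((hg i).trans (one_apply_eq i))
    ((hg j).trans (one_apply_ne hij.symm))
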